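/- Let f be an n-variable Boolean function and T ⊆ [n] a nonempty subset. Then PI_f(T) = Σ_{u ∈ F_2^n, u ≥ χ_T} (W_f(u))², where u ≥ χ_T means T ⊆ supp(u). Consequently, for every integer t with 1 ≤ t ≤ n, t-PI(f) = (1/C(n,t)) Σ_{k=t}^{n} C(k,t) · p̂_f(k). -/

import Mathlib

open Finset

namespace BF

/-- Hamming weight of a vector in `F_2^n`. -/
def wt {n : ℕ} (a : Fin n → ZMod 2) : ℕ := (univ.filter fun i => a i ≠ 0).card

/-- Normalised Walsh transform `W_f(a) = 2^{-n} Σ_x (-1)^{f(x) ⊕ ⟨x,a⟩}`. -/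
noncomputable def walsh {n : ℕ} (f : (Fin n → ZMod 2) → ZMod 2) (a : Fin n → ZMod 2) : ℝ :=
  (1 / 2 ^ n) * ∑ x : Fin n → ZMod 2, (-1 : ℝ) ^ (f x + ∑ i, x i * a i).val

/-- Normalised auto-correlation `C_f(a) = 2^{-n} Σ_x (-1)^{f(x) ⊕ f(x ⊕ a)}`. -/
noncomputable def autocorr {n : ℕ} (f : (Fin n → ZMod 2) → ZMod 2) (a : Fin n → ZMod 2) : ℝ :=
  (1 / 2 ^ n) * ∑ x : Fin n → ZMod 2, (-1 : ℝ) ^ (f x + f (x + a)).val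

/-- Influence of the set of variables `T` on `f`:
`inf_f(T) = 1 - 2^{-#T} Σ_{a ≤ χ_T} C_f(a)`. -/
noncomputable def influence {n : ℕ} (f : (Fin n → ZMod 2) → ZMod 2) (T : Finset (Fin n)) : ℝ :=
  1 - (1 / 2 ^ T.card) *
    ∑ a ∈ univ.filter (fun a : Fin n → ZMod 2 => ∀ i, a i ≠ 0 → i ∈ T), autocorr f a

/-- Total influence `t-inf(f) = (Σ_{#T = t} inf_f(T)) / C(n,t)`. -/
noncomputable def totalInf {n : ℕ} (f : (Fin n → ZMod 2) → ZMod 2) (t : ℕ) : ℝ :=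
  (∑ T ∈ univ.filter (fun T : Finset (Fin n) => T.card = t), influence f T) / (n.choose t)

/-- `p̂_f(k) = Σ_{wt(u) = k} (W_f(u))²`. -/
noncomputable def pHat {n : ℕ} (f : (Fin n → ZMod 2) → ZMod 2) (k : ℕ) : ℝ :=
  ∑ u ∈ univ.filter (fun u : Fin n → ZMod 2 => wt u = k), (walsh f u) ^ 2

/-- Pseudo-influence `PI_f(T) = 2^{-#T} Σ_{a ≤ χ_T} (-1)^{wt(a)} C_f(a)`. -/
noncomputable def pseudoInf {n : ℕ} (f : (Fin n → ZMod 2) → ZMod 2) (T : Finset (Fin n)) : ℝ :=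
  (1 / 2 ^ T.card) *
    ∑ a ∈ univ.filter (fun a : Fin n → ZMod 2 => ∀ i, a i ≠ 0 → i ∈ T),
      (-1 : ℝ) ^ wt a * autocorr f a

/-- Total pseudo-influence `t-PI(f) = (Σ_{#T = t} PI_f(T)) / C(n,t)`. -/
noncomputable def totalPI {n : ℕ} (f : (Fin n → ZMod 2) → ZMod 2) (t : ℕ) : ℝ :=
  (∑ T ∈ univ.filter (fun T : Finset (Fin n) => T.card = t), pseudoInf f T) / (n.choose t)

/-- The sign character on `F_2`. -/
noncomputable def sg (z : ZMod 2) : ℝ := (-1 : ℝ) ^ z.val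

lemma zmod_two_cases (z : ZMod 2) : z = 0 ∨ z = 1 := by
  revert z; decide

lemma sg_zero : sg 0 = 1 := by simp [sg]

lemma sg_one : sg 1 = -1 := by
  have : (1 : ZMod 2).val = 1 := by decide
  simp [sg, this]

lemma sg_add (a b : ZMod 2) : sg (a + b) = sg a * sg b := by
  have h : (1 + 1 : ZMod 2) = 0 := by decide
  rcases zmod_two_cases a with rfl | rfl <;> rcases zmod_two_cases b with rfl | rfl <;>
    simp [sg_zero, sg_one, h]

lemma sg_sum {ι : Type*} (s : Finset ι) (g : ι → ZMod 2) :
    sg (∑ i ∈ s, g i) = ∏ i ∈ s, sg (g i) := by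
  classical
  induction s using Finset.induction_on with
  | empty => simp [sg_zero]
  | insert a s ha ih => rw [Finset.sum_insert ha, Finset.prod_insert ha, sg_add, ih]

lemma walsh_sq {n : ℕ} (f : (Fin n → ZMod 2) → ZMod 2) (u : Fin n → ZMod 2) :
    walsh f u ^ 2 = (1 / 2 ^ n) * ∑ a, autocorr f a * sg (∑ i, a i * u i) := by
  have hw : walsh f u = (1 / 2 ^ n) * ∑ x, sg (f x + ∑ i, x i * u i) := rfl
  have hc : ∀ a, autocorr f a = (1 / 2 ^ n) * ∑ x, sg (f x + f (x + a)) := fun _ => rfl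
  have key : (∑ x, sg (f x + ∑ i, x i * u i)) * (∑ x, sg (f x + ∑ i, x i * u i)) =
      ∑ a, (∑ x, sg (f x + f (x + a))) * sg (∑ i, a i * u i) := by
    rw [Finset.sum_mul_sum]
    simp_rw [Finset.sum_mul]
    rw [Finset.sum_comm (s := univ) (t := univ)
      (f := fun a x => sg (f x + f (x + a)) * sg (∑ i, a i * u i))]
    refine Finset.sum_congr rfl fun x _ => ?_
    rw [← Equiv.sum_comp (Equiv.addLeft x)]
    refine Finset.sum_congr rfl fun a _ => ?_
    have h2 : ∀ z : ZMod 2, z + z = 0 := by decide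
    simp only [Equiv.coe_addLeft, Pi.add_apply, add_mul, Finset.sum_add_distrib]
    rw [← sg_add, ← sg_add]
    congr 1
    linear_combination h2 (∑ i, x i * u i)
  rw [hw, mul_pow, sq (∑ x, _), key]
  simp_rw [hc, mul_assoc]
  rw [← Finset.mul_sum]
  ring

lemma prod_sg {n : ℕ} (a : Fin n → ZMod 2) : ∏ i, sg (a i) = (-1 : ℝ) ^ wt a := by
  have h : ∀ i, sg (a i) = if a i ≠ 0 then (-1 : ℝ) else 1 := by
    intro i
    rcases zmod_two_cases (a i) with h | h <;> simp [h, sg_zero, sg_one]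
  simp_rw [h]
  rw [Finset.prod_ite]
  simp [wt]

lemma sum_char {n : ℕ} (T : Finset (Fin n)) (a : Fin n → ZMod 2) :
    ∑ u ∈ univ.filter (fun u : Fin n → ZMod 2 => ∀ i ∈ T, u i ≠ 0), sg (∑ i, a i * u i) =
      if ∀ i, a i ≠ 0 → i ∈ T then (-1 : ℝ) ^ wt a * 2 ^ (n - T.card) else 0 := by
  classical
  have hf : univ.filter (fun u : Fin n → ZMod 2 => ∀ i ∈ T, u i ≠ 0) =
      Fintype.piFinset (fun i => if i ∈ T then ({1} : Finset (ZMod 2)) else univ) := by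
    ext u
    simp only [mem_filter, mem_univ, true_and, Fintype.mem_piFinset]
    refine forall_congr' fun i => ?_
    by_cases h : i ∈ T
    · rcases zmod_two_cases (u i) with hu | hu <;> simp [h, hu]
    · simp [h]
  rw [hf]
  simp_rw [sg_sum]
  rw [← Finset.prod_univ_sum (fun i => if i ∈ T then ({1} : Finset (ZMod 2)) else univ)
    (fun i z => sg (a i * z))]
  have hu : (univ : Finset (ZMod 2)) = {0, 1} := by decide
  split_ifs with h
  · have : ∀ i, (∑ z ∈ (if i ∈ T then ({1} : Finset (ZMod 2)) else univ), sg (a i * z)) =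
        sg (a i) * if i ∈ T then 1 else 2 := by
      intro i
      by_cases hi : i ∈ T
      · simp [hi]
      · have h0 : a i = 0 := by
          by_contra h0
          exact hi (h i h0)
        simp [hi, h0, sg_zero, hu]
    simp_rw [this]
    rw [Finset.prod_mul_distrib, prod_sg, Finset.prod_ite]
    congr 1
    simp only [Finset.prod_const, one_pow, one_mul]
    congr 1
    have : univ.filter (fun i => i ∉ T) = Tᶜ := by ext; simp
    rw [this, Finset.card_compl, Fintype.card_fin]
  · push Not at h
    obtain ⟨i, h1, h2⟩ := h
    apply Finset.prod_eq_zero (mem_univ i)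
    have h1 : a i = 1 := (zmod_two_cases _).resolve_left h1
    simp [h2, h1, hu, sg_zero, sg_one]

lemma pseudoInf_eq {n : ℕ} (f : (Fin n → ZMod 2) → ZMod 2) (T : Finset (Fin n)) :
    pseudoInf f T =
      ∑ u ∈ univ.filter (fun u : Fin n → ZMod 2 => ∀ i ∈ T, u i ≠ 0), (walsh f u) ^ 2 := by
  simp_rw [walsh_sq]
  rw [← Finset.mul_sum, Finset.sum_comm]
  simp_rw [← Finset.mul_sum, sum_char]
  rw [pseudoInf, Finset.sum_filter, Finset.mul_sum, Finset.mul_sum]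
  refine Finset.sum_congr rfl fun a _ => ?_
  split_ifs with h
  · have hT : T.card ≤ n := by simpa using Finset.card_le_univ T
    have : (2 : ℝ) ^ n = 2 ^ (n - T.card) * 2 ^ T.card := by
      rw [← pow_add, Nat.sub_add_cancel hT]
    rw [this]
    field_simp
  · simp

lemma sum_pseudoInf {n : ℕ} (f : (Fin n → ZMod 2) → ZMod 2) (t : ℕ) :
    ∑ T ∈ univ.filter (fun T : Finset (Fin n) => T.card = t), pseudoInf f T =
      ∑ k ∈ Finset.Icc t n, (k.choose t : ℝ) * pHat f k := by
  have h1 : ∑ T ∈ univ.filter (fun T : Finset (Fin n) => T.card = t), pseudoInf f T =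
      ∑ u : Fin n → ZMod 2, ((wt u).choose t : ℝ) * walsh f u ^ 2 := by
    simp_rw [pseudoInf_eq, Finset.sum_filter (fun u : Fin n → ZMod 2 => _)]
    rw [Finset.sum_comm]
    refine Finset.sum_congr rfl fun u _ => ?_
    rw [← Finset.sum_filter, Finset.sum_const, nsmul_eq_mul]
    congr 2
    rw [wt, ← Finset.card_powersetCard]
    congr 1
    ext T
    simp [Finset.mem_powersetCard, Finset.subset_iff, and_comm]
  have h2 : ∑ k ∈ Finset.Icc t n, (k.choose t : ℝ) * pHat f k =
      ∑ k ∈ Finset.range (n + 1), (k.choose t : ℝ) * pHat f k := by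
    apply Finset.sum_subset
    · intro k hk
      simp at hk ⊢
      omega
    · intro k hk hk'
      simp at hk hk'
      have : k < t := by
        by_contra h
        have := hk' (by omega)
        omega
      simp [Nat.choose_eq_zero_of_lt this]
  rw [h1, h2]
  rw [← Finset.sum_fiberwise_of_maps_to (s := univ) (t := Finset.range (n + 1)) (g := wt)]
  · refine Finset.sum_congr rfl fun k _ => ?_
    rw [pHat, Finset.mul_sum]
    refine Finset.sum_congr rfl fun u hu => ?_
    rw [(Finset.mem_filter.mp hu).2]
  · intro u _
    have : wt u ≤ n := by
      simpa [wt] using Finset.card_le_univ (univ.filter fun i => u i ≠ 0)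
    simp
    omega

/-- `PI_f(T) = Σ_{u ≥ χ_T} (W_f(u))²`, and consequently
`t-PI(f) = (1/C(n,t)) Σ_{k=t}^n C(k,t) p̂_f(k)`. -/
theorem pseudoInf_eq_sum_walsh_sq {n : ℕ} (f : (Fin n → ZMod 2) → ZMod 2) :
    (∀ T : Finset (Fin n), T.Nonempty →
        pseudoInf f T =
          ∑ u ∈ univ.filter (fun u : Fin n → ZMod 2 => ∀ i ∈ T, u i ≠ 0), (walsh f u) ^ 2) ∧
      ∀ t : ℕ, 1 ≤ t → t ≤ n →
        totalPI f t = (1 / (n.choose t : ℝ)) *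
          ∑ k ∈ Finset.Icc t n, (k.choose t : ℝ) * pHat f k := by
  refine ⟨fun T _ => pseudoInf_eq f T, fun t _ _ => ?_⟩
  rw [totalPI, sum_pseudoInf]
  ring

end BF
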